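/- Let p be prime, a and s positive integers, G = (Z_{p^a})^{2s}, and U any subgroup of G of order p^{as}. Then there exists a (p^{(a-1)s}, p^s) LP-packing in G relative to U; that is, a collection of p^s disjoint regular (p^{as}, p^{(a-1)s}) Latin square type partial difference sets in G whose union is G∖U. -/

import Mathlib

open Finset BigOperators

variable {G : Type*}

/-- Number of ordered pairs `(x,y)` with `x,y ∈ D`, `x ≠ y`, `x * y⁻¹ = g`. -/
noncomputable def diffCount [Group G] (D : Set G) (g : G) : ℕ :=
  Nat.card {p : G × G // p.1 ∈ D ∧ p.2 ∈ D ∧ p.1 ≠ p.2 ∧ p.1 * p.2⁻¹ = g}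

/-- `D` is a `(v,k,λ,μ)` partial difference set in `G`. -/
def IsPDS [Group G] (D : Set G) (v k : ℕ) (l m : ℤ) : Prop :=
  Nat.card G = v ∧ Nat.card D = k ∧
    ∀ g : G, g ≠ 1 →
      (g ∈ D → (diffCount D g : ℤ) = l) ∧ (g ∉ D → (diffCount D g : ℤ) = m)

/-- A regular PDS: a PDS avoiding the identity and closed under inversion. -/
def IsRegularPDS [Group G] (D : Set G) (v k : ℕ) (l m : ℤ) : Prop :=
  IsPDS D v k l m ∧ (1 : G) ∉ D ∧ D⁻¹ = D

/-- A regular `(n,r)` Latin square type PDS. -/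
def IsLatinPDS [Group G] (D : Set G) (n r : ℕ) : Prop :=
  IsRegularPDS D (n ^ 2) (r * (n - 1)) ((n : ℤ) + (r : ℤ) ^ 2 - 3 * r) ((r : ℤ) ^ 2 - r)

/-- A regular `(n,r)` negative Latin square type PDS. -/
def IsNegLatinPDS [Group G] (D : Set G) (n r : ℕ) : Prop :=
  IsRegularPDS D (n ^ 2) (r * (n + 1)) (-(n : ℤ) + (r : ℤ) ^ 2 + 3 * r) ((r : ℤ) ^ 2 + r)

/-- Character sum `χ(D) = ∑_{d ∈ D} χ(d)`. -/
noncomputable def charSum [Group G] (χ : G →* ℂˣ) (D : Set G) : ℂ :=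
  ∑ᶠ d ∈ D, (χ d : ℂ)

/-- The multiset of character sums `{χ(P 0), …, χ(P (t-1))}`. -/
noncomputable def charMultiset [Group G] {t : ℕ} (χ : G →* ℂˣ) (P : Fin t → Set G) :
    Multiset ℂ :=
  (Finset.univ.val : Multiset (Fin t)).map fun i => charSum χ (P i)

/-- `χ` is principal on the subgroup `U`. -/
def IsPrincipalOn [Group G] (χ : G →* ℂˣ) (U : Subgroup G) : Prop :=
  ∀ u ∈ U, χ u = 1

/-- A `(c,t)` LP-packing in `G` relative to `U`. -/
def IsLPPacking [CommGroup G] (c t : ℕ) (P : Fin t → Set G) (U : Subgroup G) : Prop :=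
  Nat.card G = t ^ 2 * c ^ 2 ∧ Nat.card U = t * c ∧
    (∀ i, IsLatinPDS (P i) (t * c) c) ∧
    (∀ i j, i ≠ j → Disjoint (P i) (P j)) ∧
    (⋃ i, P i) = Set.univ \ (U : Set G)

/-- A `(c,t-1)` NLP-packing in `G`. -/
def IsNLPPacking [CommGroup G] (c t : ℕ) (P : Fin (t - 1) → Set G) : Prop :=
  Nat.card G = t ^ 2 * c ^ 2 ∧
    (∀ i, IsNegLatinPDS (P i) (t * c) c) ∧
    IsNegLatinPDS (Set.univ \ ({1} ∪ ⋃ i, P i)) (t * c) (c - 1)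

/-- A `(c,t)` LP-partition in `G − V` relative to `H`. -/
def IsLPPartition [CommGroup G] (c t : ℕ) (R : Fin t → Set G) (V H : Subgroup G) : Prop :=
  Nat.card G = t ^ 2 * c ^ 2 ∧ Nat.card V = t * c ^ 2 ∧ H ≤ V ∧
    (∀ i, Nat.card (R i) = (t - 1) * c ^ 2) ∧
    (∀ i j, i ≠ j → Disjoint (R i) (R j)) ∧
    (⋃ i, R i) = Set.univ \ (V : Set G) ∧
    ∀ χ : G →* ℂˣ, χ ≠ 1 →
      (IsPrincipalOn χ V → charMultiset χ R = Multiset.replicate t (-(c : ℂ) ^ 2)) ∧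
      (¬ IsPrincipalOn χ V → IsPrincipalOn χ H →
        charMultiset χ R = Multiset.replicate t 0) ∧
      (¬ IsPrincipalOn χ H →
        charMultiset χ R = ((t : ℂ) - 1) * (c : ℂ) ::ₘ Multiset.replicate (t - 1) (-(c : ℂ)))

/-- Over `ZMod p` there are irreducible monic polynomials of every positive degree. -/
lemma exists_monic_irreducible_natDegree_eq (p s : ℕ) [Fact p.Prime] (hs : 0 < s) :
    ∃ f : Polynomial (ZMod p), f.Monic ∧ Irreducible f ∧ f.natDegree = s := by
  obtain ⟨x, hx⟩ := Field.exists_primitive_element (ZMod p) (GaloisField p s)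
  have hi : IsIntegral (ZMod p) x := Algebra.IsIntegral.isIntegral x
  refine ⟨minpoly (ZMod p) x, minpoly.monic hi, minpoly.irreducible hi, ?_⟩
  rw [← IntermediateField.adjoin.finrank hi, hx, IntermediateField.finrank_top',
    GaloisField.finrank p hs.ne']

lemma Polynomial.dvd_of_map_castHom_eq_zero {p n : ℕ} (h : p ∣ n) {g : Polynomial (ZMod n)}
    (hg : g.map (ZMod.castHom h (ZMod p)) = 0) : (p : Polynomial (ZMod n)) ∣ g := by
  rw [show (p : Polynomial (ZMod n)) = Polynomial.C (p : ZMod n) by simp,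
    Polynomial.C_dvd_iff_dvd_coeff]
  intro i
  have hi : (ZMod.castHom h (ZMod p)) (g.coeff i) = 0 := by
    rw [← Polynomial.coeff_map, hg, Polynomial.coeff_zero]
  obtain ⟨z, hz⟩ := ZMod.intCast_surjective (g.coeff i)
  rw [← hz, map_intCast, ZMod.intCast_zmod_eq_zero_iff_dvd] at hi
  obtain ⟨w, rfl⟩ := hi
  exact ⟨(w : ZMod n), by rw [← hz]; push_cast; rfl⟩

/-- Galois rings exist. -/
lemma exists_galoisRing (p a s : ℕ) (hp : p.Prime) (ha : 0 < a) (hs : 0 < s) :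
    ∃ (R : Type) (_ : CommRing R) (_ : Algebra (ZMod (p ^ a)) R)
      (_ : Module.Basis (Fin s) (ZMod (p ^ a)) R), ∀ x : R, IsUnit x ∨ (p : R) ∣ x := by
  have : Fact p.Prime := ⟨hp⟩
  have : Fact (1 < p ^ a) := ⟨Nat.one_lt_pow ha.ne' hp.one_lt⟩
  have hpa : p ∣ p ^ a := dvd_pow_self p ha.ne'
  set φ := ZMod.castHom hpa (ZMod p) with hφ
  have hsurj : Function.Surjective φ := ZMod.castHom_surjective hpa
  have hlift : ∀ g : Polynomial (ZMod p), ∃ g', Polynomial.map φ g' = g :=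
    Polynomial.map_surjective φ hsurj
  obtain ⟨f₀, hf₀, hirr, hdeg₀⟩ := exists_monic_irreducible_natDegree_eq p s hs
  obtain ⟨f, hf, hdeg, hmon⟩ := Polynomial.lifts_and_natDegree_eq_and_monic
    (f := φ) (p := f₀) ((Polynomial.mem_lifts _).2 (hlift f₀)) hf₀
  have hdim : (AdjoinRoot.powerBasis' hmon).dim = s := by
    rw [AdjoinRoot.powerBasis'_dim, hdeg, hdeg₀]
  refine ⟨AdjoinRoot f, inferInstance, inferInstance,
    (AdjoinRoot.powerBasis' hmon).basis.reindex (finCongr hdim), fun x => ?_⟩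
  obtain ⟨g, rfl⟩ := AdjoinRoot.mk_surjective x
  by_cases hd : f₀ ∣ g.map φ
  · right
    obtain ⟨k, hk⟩ := hd
    obtain ⟨k', rfl⟩ := hlift k
    have h0 : (g - f * k').map φ = 0 := by
      rw [Polynomial.map_sub, Polynomial.map_mul, hf, hk, sub_self]
    obtain ⟨h, hh⟩ := Polynomial.dvd_of_map_castHom_eq_zero hpa h0
    refine ⟨AdjoinRoot.mk f h, ?_⟩
    have := congrArg (AdjoinRoot.mk f) hh
    simpa using this
  · left
    obtain ⟨u, v, huv⟩ := (hirr.coprime_iff_not_dvd).2 hd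
    obtain ⟨u, rfl⟩ := hlift u
    obtain ⟨v, rfl⟩ := hlift v
    have h0 : (u * f + v * g - 1).map φ = 0 := by
      rw [Polynomial.map_sub, Polynomial.map_add, Polynomial.map_mul, Polynomial.map_mul, hf, huv,
        Polynomial.map_one, sub_self]
    obtain ⟨h, hh⟩ := Polynomial.dvd_of_map_castHom_eq_zero hpa h0
    have h1 := congrArg (AdjoinRoot.mk f) hh
    simp only [map_sub, map_add, map_mul, AdjoinRoot.mk_self, mul_zero, zero_add, map_one,
      map_natCast] at h1
    have hnil : IsNilpotent ((p : AdjoinRoot f) * AdjoinRoot.mk f h) := by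
      refine ⟨a, ?_⟩
      have : ((p : AdjoinRoot f)) ^ a = 0 := by
        have := congrArg (algebraMap (ZMod (p ^ a)) (AdjoinRoot f)) (ZMod.natCast_self (p ^ a))
        rwa [map_natCast, Nat.cast_pow, map_zero] at this
      rw [mul_pow, this, zero_mul]
    have hu : IsUnit (AdjoinRoot.mk f v * AdjoinRoot.mk f g) := by
      rw [sub_eq_iff_eq_add.1 h1, add_comm]
      exact hnil.isUnit_one_add
    exact isUnit_of_mul_isUnit_right hu

lemma AddMonoidHom.card_ker_mul_card_range {A B : Type*} [AddGroup A] [AddGroup B] (f : A →+ B) :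
    Nat.card f.ker * Nat.card f.range = Nat.card A := by
  rw [← AddSubgroup.index_ker, AddSubgroup.card_mul_index]

/-- The subgroup of elements of `A` killed by `m`. -/
abbrev torsionKer (A : Type*) [AddCommGroup A] (m : ℕ) : AddSubgroup A :=
  (nsmulAddMonoidHom (α := A) m).ker

lemma mem_torsionKer {A : Type*} [AddCommGroup A] {m : ℕ} {x : A} :
    x ∈ torsionKer A m ↔ m • x = 0 := Iff.rfl

lemma card_torsionKer_pow_le (A : Type*) [AddCommGroup A] [Finite A] (p k : ℕ) :
    Nat.card (torsionKer A (p ^ k)) ≤ Nat.card (torsionKer A p) ^ k := by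
  induction k with
  | zero =>
    have : torsionKer A (p ^ 0) = ⊥ := by
      ext x; simp
    rw [this]; simp
  | succ k ih =>
    set f := (nsmulAddMonoidHom (α := A) (p ^ k)).comp (torsionKer A (p ^ (k + 1))).subtype
    refine f.card_ker_mul_card_range.symm.trans_le ?_
    rw [pow_succ (Nat.card _)]
    refine Nat.mul_le_mul (le_trans ?_ ih) ?_
    · refine Nat.card_le_card_of_injective
        (fun x => (⟨x.1.1, x.2⟩ : torsionKer A (p ^ k))) fun x y h => ?_
      have h' := congrArg Subtype.val h
      exact Subtype.ext (Subtype.ext h')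
    · refine AddSubgroup.card_le_of_le ?_
      rintro _ ⟨x, rfl⟩
      have := x.2
      rw [mem_torsionKer] at this
      rw [mem_torsionKer]
      change p • (p ^ k • (x : A)) = 0
      rw [← mul_nsmul', ← pow_succ']
      exact this

/-- In a finite group which is homocyclic of exponent `p ^ a`, every element of order dividing `p`
is a multiple of `p ^ (a - 1)`. -/
lemma exists_pow_nsmul_eq {A : Type*} [AddCommGroup A] [Finite A] {p a M : ℕ}
    (hexp : ∀ x : A, p ^ (a + 1) • x = 0) (hcard : Nat.card A = M ^ (a + 1))
    (htors : Nat.card (torsionKer A p) ≤ M) {x : A} (hx : p • x = 0) : ∃ y, p ^ a • y = x := by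
  set f := nsmulAddMonoidHom (α := A) (p ^ a) with hf
  have hpos : 0 < M := Nat.card_pos.trans_le htors
  have hle : f.range ≤ torsionKer A p := by
    rintro _ ⟨x, rfl⟩
    rw [mem_torsionKer, hf, nsmulAddMonoidHom_apply, ← mul_nsmul', ← pow_succ']
    exact hexp x
  have h1 : M ≤ Nat.card f.range := by
    have h2 := f.card_ker_mul_card_range
    have h3 : Nat.card f.ker ≤ M ^ a :=
      (card_torsionKer_pow_le A p a).trans (Nat.pow_le_pow_left htors a)
    rw [hcard, pow_succ] at h2
    exact Nat.le_of_mul_le_mul_left (h2 ▸ Nat.mul_le_mul_right _ h3) (pow_pos hpos a)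
  have heq := AddSubgroup.eq_of_le_of_card_ge hle (htors.trans h1)
  have : x ∈ f.range := by rw [heq]; exact hx
  exact this

lemma card_torsionKer_eq {A : Type*} [AddCommGroup A] [Finite A] {p a M : ℕ}
    (hexp : ∀ x : A, p ^ (a + 1) • x = 0) (hcard : Nat.card A = M ^ (a + 1))
    (htors : Nat.card (torsionKer A p) ≤ M) : Nat.card (torsionKer A p) = M := by
  refine le_antisymm htors ?_
  have h : torsionKer A (p ^ (a + 1)) = ⊤ := by
    ext x; simpa [mem_torsionKer] using hexp x
  have h2 := card_torsionKer_pow_le A p (a + 1)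
  rw [h, AddSubgroup.card_top, hcard] at h2
  exact (Nat.pow_le_pow_iff_left (Nat.succ_ne_zero a)).1 h2

lemma card_range_pow_le (p k : ℕ) : ∀ (A : Type) [AddCommGroup A] [Finite A],
    (∀ x : A, p ^ (k + 1) • x = 0) →
    Nat.card (nsmulAddMonoidHom (α := A) (p ^ k)).range ^ (k + 1) ≤ Nat.card A := by
  induction k with
  | zero =>
    intro A _ _ _
    simp
  | succ k ih =>
    intro A _ _ hA
    set B := (nsmulAddMonoidHom (α := A) p).range
    have hB : ∀ x : B, p ^ (k + 1) • x = 0 := by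
      rintro ⟨_, y, rfl⟩
      apply Subtype.ext
      change p ^ (k + 1) • (p • y) = 0
      rw [← mul_nsmul', ← pow_succ]
      exact hA y
    have h1 : Nat.card (nsmulAddMonoidHom (α := A) (p ^ (k + 1))).range ≤
        Nat.card (nsmulAddMonoidHom (α := B) (p ^ k)).range := by
      rw [← AddSubgroup.card_map_of_injective (f := B.subtype) (Subtype.val_injective)]
      refine AddSubgroup.card_le_of_le ?_
      rintro _ ⟨y, rfl⟩
      refine ⟨p ^ k • ⟨p • y, y, rfl⟩, ⟨_, rfl⟩, ?_⟩
      change p ^ k • (p • y) = p ^ (k + 1) • y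
      rw [← mul_nsmul', ← pow_succ]
    have h2 : (nsmulAddMonoidHom (α := A) (p ^ (k + 1))).range ≤ torsionKer A p := by
      rintro _ ⟨y, rfl⟩
      rw [mem_torsionKer, nsmulAddMonoidHom_apply, ← mul_nsmul', ← pow_succ']
      exact hA y
    rw [← (nsmulAddMonoidHom (α := A) p).card_ker_mul_card_range, pow_succ, mul_comm]
    exact Nat.mul_le_mul (AddSubgroup.card_le_of_le h2)
      ((Nat.pow_le_pow_left h1 _).trans (ih B hB))

lemma exists_between_addSubgroup {G : Type} [AddCommGroup G] [Finite G] {p a s : ℕ} (hp : p.Prime)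
    (U : AddSubgroup G) (hexp : ∀ x : G, p ^ (a + 1) • x = 0)
    (hU : Nat.card U = p ^ ((a + 1) * s)) :
    ∃ H : AddSubgroup G, H ≤ U ∧ (∀ x ∈ H, p • x = 0) ∧ Nat.card H = p ^ s ∧
      ∀ x ∈ U, p ^ a • x ∈ H := by
  have : Fact p.Prime := ⟨hp⟩
  have hexpU : ∀ x : U, p ^ (a + 1) • x = 0 := fun x => Subtype.ext (hexp x)
  set T := torsionKer U p with hT
  set I := (nsmulAddMonoidHom (α := U) (p ^ a)).range with hI
  have hIT : I ≤ T := by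
    rintro _ ⟨y, rfl⟩
    rw [mem_torsionKer, nsmulAddMonoidHom_apply, ← mul_nsmul', ← pow_succ']
    exact hexpU y
  obtain ⟨t, -, ht⟩ := (Nat.dvd_prime_pow hp).1 (hU ▸ AddSubgroup.card_addSubgroup_dvd_card T)
  obtain ⟨r, -, hr⟩ := (Nat.dvd_prime_pow hp).1 (hU ▸ AddSubgroup.card_addSubgroup_dvd_card I)
  have hst : s ≤ t := by
    have h : torsionKer U (p ^ (a + 1)) = ⊤ := by
      ext x; simpa [mem_torsionKer] using hexpU x
    have h2 := card_torsionKer_pow_le U p (a + 1)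
    rw [h, AddSubgroup.card_top, hU, ht, ← pow_mul, Nat.pow_le_pow_iff_right hp.one_lt,
      mul_comm] at h2
    exact Nat.le_of_mul_le_mul_right h2 (Nat.succ_pos a)
  have hrs : r ≤ s := by
    have h2 := card_range_pow_le p a U hexpU
    rw [hU, ← hI, hr, ← pow_mul, Nat.pow_le_pow_iff_right hp.one_lt, mul_comm] at h2
    exact Nat.le_of_mul_le_mul_left h2 (Nat.succ_pos a)
  obtain ⟨K, hK, hIK⟩ := Sylow.exists_subgroup_card_pow_prime_le (G := Multiplicative T) p
    (n := r) (m := s) (by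
      rw [Nat.card_congr Multiplicative.toAdd, ht]
      exact pow_dvd_pow p hst) (AddSubgroup.toSubgroup (I.addSubgroupOf T)) (by
      rw [← hr]
      exact Nat.card_congr (AddSubgroup.addSubgroupOfEquivOfLe hIT).toEquiv) hrs
  set K' : AddSubgroup T := AddSubgroup.toSubgroup.symm K with hK'
  have hcK' : Nat.card K' = p ^ s := hK
  have hIK' : ∀ x (hx : x ∈ T), x ∈ I → (⟨x, hx⟩ : T) ∈ K' := fun x hx hxI =>
    hIK (show Multiplicative.ofAdd (⟨x, hx⟩ : T) ∈ _ from hxI)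
  refine ⟨(K'.map T.subtype).map U.subtype, ?_, ?_, ?_, ?_⟩
  · rintro _ ⟨x, -, rfl⟩
    exact x.2
  · rintro _ ⟨_, ⟨x, -, rfl⟩, rfl⟩
    exact congrArg Subtype.val (mem_torsionKer.1 x.2)
  · rw [AddSubgroup.card_map_of_injective Subtype.val_injective,
      AddSubgroup.card_map_of_injective Subtype.val_injective, hcK']
  · intro x hx
    have hxI : p ^ a • (⟨x, hx⟩ : U) ∈ I := ⟨_, rfl⟩
    exact ⟨_, ⟨_, hIK' _ (hIT hxI) hxI, rfl⟩, rfl⟩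

lemma card_torsionKer_zmod_le (n p : ℕ) [NeZero n] (hp : 0 < p) :
    Nat.card (torsionKer (ZMod n) p) ≤ p := by
  classical
  have h := IsAddCyclic.card_nsmul_eq_zero_le (α := ZMod n) hp
  rw [← Fintype.card_subtype] at h
  rwa [← Nat.card_eq_fintype_card] at h

lemma card_torsionKer_le_of_basis {R : Type*} [AddCommGroup R] {n p s : ℕ} [NeZero n]
    [Module (ZMod n) R] (b : Module.Basis (Fin s) (ZMod n) R) (hp : 0 < p) :
    Nat.card (torsionKer R p) ≤ p ^ s := by
  have h : Nat.card (torsionKer R p) ≤ Nat.card (Fin s → torsionKer (ZMod n) p) := by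
    refine Nat.card_le_card_of_injective (fun x i => ⟨b.repr x.1 i, ?_⟩) fun x y hxy => ?_
    · rw [mem_torsionKer, ← Finsupp.smul_apply, ← map_nsmul, mem_torsionKer.1 x.2]
      simp
    · refine Subtype.ext (b.repr.injective (Finsupp.ext fun i => ?_))
      exact congrArg Subtype.val (congrFun hxy i)
  refine h.trans ?_
  rw [Nat.card_fun, Nat.card_fin]
  exact Nat.pow_le_pow_left (card_torsionKer_zmod_le n p hp) s

lemma ZMod.finrank_eq_of_card_eq_pow {p : ℕ} [Fact p.Prime] (W : Type*) [AddCommGroup W]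
    [Module (ZMod p) W] [Finite W] (k : ℕ) (hk : Nat.card W = p ^ k) :
    Module.finrank (ZMod p) W = k := by
  have := Fintype.ofFinite W
  have h := Module.card_eq_pow_finrank (K := ZMod p) (V := W)
  rw [← Nat.card_eq_fintype_card, hk, ZMod.card] at h
  exact (Nat.pow_right_injective (Fact.out : p.Prime).two_le h).symm

lemma exists_addMonoidHom_complement {p s : ℕ} (hp : p.Prime) {A J : Type*} [AddCommGroup A]
    [AddCommGroup J] [Finite A] [Finite J] [Module (ZMod p) A] [Module (ZMod p) J]
    (cA : Nat.card A = p ^ (2 * s)) (cJ : Nat.card J = p ^ s) (H : AddSubgroup A)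
    (cH : Nat.card H = p ^ s) :
    ∃ f h : J →+ A, h.range = H ∧ ∀ x y, f x + h y = 0 → x = 0 ∧ y = 0 := by
  have : Fact p.Prime := ⟨hp⟩
  set H' : Submodule (ZMod p) A := AddSubgroup.toZModSubmodule p H with hH'
  obtain ⟨C, hC⟩ := H'.exists_isCompl
  have rA : Module.finrank (ZMod p) A = 2 * s := ZMod.finrank_eq_of_card_eq_pow A _ cA
  have rJ : Module.finrank (ZMod p) J = s := ZMod.finrank_eq_of_card_eq_pow J _ cJ
  have rH : Module.finrank (ZMod p) H' = s := ZMod.finrank_eq_of_card_eq_pow (p := p) (↥H') s cH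
  have rC : Module.finrank (ZMod p) C = s := by
    have := Submodule.finrank_add_eq_of_isCompl hC
    omega
  let eH : J ≃ₗ[ZMod p] H' := LinearEquiv.ofFinrankEq J H' (rJ.trans rH.symm)
  let eC : J ≃ₗ[ZMod p] C := LinearEquiv.ofFinrankEq J C (rJ.trans rC.symm)
  refine ⟨(C.subtype.comp eC.toLinearMap).toAddMonoidHom,
    (H'.subtype.comp eH.toLinearMap).toAddMonoidHom, ?_, ?_⟩
  · ext x
    constructor
    · rintro ⟨y, rfl⟩
      exact (eH y).2
    · intro hx
      exact ⟨eH.symm ⟨x, hx⟩, by simp⟩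
  · intro x y hxy
    have hxy' : (eC x : A) = -(eH y : A) := eq_neg_of_add_eq_zero_left hxy
    have h0 : (eC x : A) = 0 :=
      (Submodule.disjoint_def.1 hC.disjoint) _ (by rw [hxy']; exact H'.neg_mem (eH y).2) (eC x).2
    have h1 : (eH y : A) = 0 := by rw [h0] at hxy'; exact (neg_eq_zero.1 hxy'.symm)
    exact ⟨eC.map_eq_zero_iff.1 (Subtype.ext h0), eH.map_eq_zero_iff.1 (Subtype.ext h1)⟩

lemma exists_addMonoidHom_extend {p a s : ℕ} {R G : Type*} [AddCommGroup R] [AddCommGroup G]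
    [Module (ZMod (p ^ (a + 1))) R] (b : Module.Basis (Fin s) (ZMod (p ^ (a + 1))) R)
    (hR : ∀ x : R, p • x = 0 → ∃ y, p ^ a • y = x)
    [Module (ZMod (p ^ (a + 1))) G] (hG : ∀ x : G, p • x = 0 → ∃ y, p ^ a • y = x)
    (θ : torsionKer R p →+ G) : ∃ α : R →+ G, ∀ x : torsionKer R p, α x = θ x := by
  have hR' : ∀ x : R, p ^ a • x ∈ torsionKer R p := by
    intro x
    rw [mem_torsionKer, ← mul_nsmul', ← pow_succ', ← Nat.cast_smul_eq_nsmul (ZMod (p ^ (a + 1))),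
      ZMod.natCast_self, zero_smul]
  let μ : R →+ G := θ.comp ((nsmulAddMonoidHom (α := R) (p ^ a)).codRestrict _ hR')
  have hμ : ∀ i, ∃ g, p ^ a • g = μ (b i) := by
    intro i
    apply hG
    change p • θ ⟨_, hR' (b i)⟩ = 0
    rw [← map_nsmul, ← map_zero θ]
    exact congrArg θ (Subtype.ext (hR' (b i)))
  choose g hg using hμ
  let α : R →ₗ[ZMod (p ^ (a + 1))] G := b.constr ℕ g
  have hα : (p ^ a) • α = μ.toZModLinearMap (p ^ (a + 1)) := by
    refine b.ext fun i => ?_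
    simp [α, hg]
  refine ⟨α.toAddMonoidHom, fun x => ?_⟩
  obtain ⟨y, hy⟩ := hR x x.2
  have h1 := LinearMap.congr_fun hα y
  have h2 : μ y = θ x := congrArg θ (Subtype.ext hy)
  rw [← h2]
  change α x = _
  rw [← hy, map_nsmul]
  exact h1

/-- A homocyclic group of rank `2 * s` with a subgroup `H` of order `p ^ s` killed by `p` is the
square of a Galois ring `R`, in such a way that `H` becomes `0 × R[p]`. -/
lemma exists_addEquiv_prod {p a s : ℕ} (hp : p.Prime) {R G : Type*} [AddCommGroup R]
    [AddCommGroup G] [Finite R] [Finite G]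
    [Module (ZMod (p ^ (a + 1))) R] (b : Module.Basis (Fin s) (ZMod (p ^ (a + 1))) R)
    (cR : Nat.card R = (p ^ s) ^ (a + 1))
    (hexp : ∀ x : G, p ^ (a + 1) • x = 0) (cG : Nat.card G = (p ^ (2 * s)) ^ (a + 1))
    (tG : Nat.card (torsionKer G p) ≤ p ^ (2 * s)) (H : AddSubgroup G) (hH : ∀ x ∈ H, p • x = 0)
    (cH : Nat.card H = p ^ s) :
    ∃ e : R × R ≃+ G, ∀ z : R × R, e z ∈ H ↔ z.1 = 0 ∧ p • z.2 = 0 := by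
  have : NeZero (p ^ (a + 1)) := ⟨(pow_pos hp.pos _).ne'⟩
  have hexpR : ∀ x : R, p ^ (a + 1) • x = 0 := by
    intro x
    rw [← Nat.cast_smul_eq_nsmul (ZMod (p ^ (a + 1))), ZMod.natCast_self, zero_smul]
  have tR := card_torsionKer_le_of_basis b hp.pos
  have hR : ∀ x : R, p • x = 0 → ∃ y, p ^ a • y = x := fun x hx =>
    exists_pow_nsmul_eq hexpR cR tR hx
  have hG : ∀ x : G, p • x = 0 → ∃ y, p ^ a • y = x := fun x hx =>
    exists_pow_nsmul_eq hexp cG tG hx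
  let _ : Module (ZMod (p ^ (a + 1))) G := AddCommGroup.zmodModule hexp
  let _ : Module (ZMod p) (torsionKer G p) :=
    AddCommGroup.zmodModule fun x => Subtype.ext x.2
  let _ : Module (ZMod p) (torsionKer R p) :=
    AddCommGroup.zmodModule fun x => Subtype.ext x.2
  obtain ⟨f, h, hr, hfh⟩ := exists_addMonoidHom_complement hp (A := torsionKer G p)
    (J := torsionKer R p)
    (card_torsionKer_eq hexp cG tG) (card_torsionKer_eq hexpR cR tR)
    (H.addSubgroupOf (torsionKer G p))
    ((Nat.card_congr (AddSubgroup.addSubgroupOfEquivOfLe hH).toEquiv).trans cH)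
  obtain ⟨α, hα⟩ := exists_addMonoidHom_extend b hR hG ((torsionKer G p).subtype.comp f)
  obtain ⟨β, hβ⟩ := exists_addMonoidHom_extend b hR hG ((torsionKer G p).subtype.comp h)
  have htor : ∀ x y : R, p • x = 0 → p • y = 0 → α x + β y = 0 → x = 0 ∧ y = 0 := by
    intro x y hx hy hxy
    have h1 := hα ⟨x, hx⟩
    have h2 := hβ ⟨y, hy⟩
    have h3 := hfh ⟨x, hx⟩ ⟨y, hy⟩ (Subtype.ext (by
      simp only [AddMonoidHom.comp_apply] at h1 h2
      rw [h1, h2] at hxy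
      exact hxy))
    exact ⟨congrArg Subtype.val h3.1, congrArg Subtype.val h3.2⟩
  have hinj : Function.Injective (α.coprod β) := by
    rw [injective_iff_map_eq_zero]
    rintro ⟨x, y⟩ hxy
    have key : ∀ k, p ^ k • x = 0 ∧ p ^ k • y = 0 → x = 0 ∧ y = 0 := by
      intro k
      induction k with
      | zero => simp
      | succ k ih =>
        rintro ⟨hx, hy⟩
        rw [pow_succ', mul_nsmul'] at hx hy
        refine ih (htor _ _ hx hy ?_)
        rw [map_nsmul, map_nsmul, ← nsmul_add]
        rw [AddMonoidHom.coprod_apply] at hxy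
        rw [hxy, nsmul_zero]
    exact Prod.ext_iff.2 (key (a + 1) ⟨hexpR x, hexpR y⟩)
  have hbij : Function.Bijective (α.coprod β) := by
    refine (Nat.bijective_iff_injective_and_card _).2 ⟨hinj, ?_⟩
    rw [Nat.card_prod, cR, cG]
    ring
  refine ⟨AddEquiv.ofBijective _ hbij, fun z => ?_⟩
  rw [AddEquiv.ofBijective_apply]
  constructor
  · intro hz
    have hz' : (⟨_, hH _ hz⟩ : torsionKer G p) ∈ h.range := by rw [hr]; exact hz
    obtain ⟨y, hy⟩ := hz'
    have h1 : β y = α.coprod β z := (hβ y).trans (congrArg Subtype.val hy)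
    have h2 : z = (0, (y : R)) := hinj (by rw [← h1]; simp)
    rw [h2]
    exact ⟨rfl, y.2⟩
  · rintro ⟨h1, h2⟩
    have h3 : h ⟨z.2, h2⟩ ∈ H.addSubgroupOf (torsionKer G p) := by rw [← hr]; exact ⟨_, rfl⟩
    have h4 := hβ ⟨z.2, h2⟩
    rw [AddMonoidHom.coprod_apply, h1, map_zero, zero_add]
    simp only at h4
    rw [h4]
    exact h3

/-- The sum of the character `χ` over the set `D`. -/
noncomputable def addCharSum {G : Type*} [AddCommGroup G] (χ : AddChar G ℂ) (D : Set G) : ℂ :=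
  ∑ᶠ g, D.indicator χ g

lemma addCharSum_eq_sum {G : Type*} [AddCommGroup G] [Fintype G] (χ : AddChar G ℂ) (D : Set G) :
    addCharSum χ D = ∑ g, D.indicator χ g :=
  finsum_eq_sum_of_fintype _

open Classical in
lemma sum_comp_addMonoidHom {X Y : Type*} [AddCommGroup X] [AddCommGroup Y] [Fintype X] [Fintype Y]
    (f : X →+ Y) (F : Y → ℂ) :
    ∑ x, F (f x) = Nat.card f.ker * ∑ y, if y ∈ f.range then F y else 0 := by
  rw [← Finset.sum_fiberwise Finset.univ f, Finset.mul_sum]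
  refine Finset.sum_congr rfl fun y _ => ?_
  rw [Finset.sum_congr rfl (g := fun _ => F y) (fun x hx => by rw [(Finset.mem_filter.1 hx).2]),
    Finset.sum_const, nsmul_eq_mul]
  split_ifs with hy
  · rw [AddMonoidHom.card_fiber_eq_of_mem_range f (y := 0) hy ⟨0, map_zero f⟩,
      ← Fintype.card_subtype, ← Nat.card_eq_fintype_card]
    rfl
  · have : ({x | f x = y} : Finset X) = ∅ := by
      ext x
      simp only [Finset.mem_filter, Finset.mem_univ, true_and, Finset.notMem_empty, iff_false]
      exact fun h => hy ⟨x, h⟩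
    rw [this]
    simp

lemma AddChar.eq_zero_iff_forall {A : Type*} [AddCommGroup A] (ψ : AddChar A ℂ) :
    ψ = 0 ↔ ∀ x, ψ x = 1 :=
  DFunLike.ext_iff

section ChainRing

variable {R : Type*} [CommRing R] {p q a : ℕ}

lemma isUnit_iff_not_dvd [Nontrivial R] (hR : ∀ x : R, IsUnit x ∨ (p : R) ∣ x)
    (hp : (p : R) ^ (a + 1) = 0) (x : R) : IsUnit x ↔ ¬ (p : R) ∣ x := by
  refine ⟨fun hx hd => ?_, fun h => (hR x).resolve_right h⟩
  have h1 : IsUnit (p : R) := isUnit_of_dvd_unit hd hx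
  have h2 := h1.pow (a + 1)
  rw [hp] at h2
  exact not_isUnit_zero h2

/-- `R[p]` is contained in every nonzero ideal of `R`. -/
lemma exists_eq_mul_of_nsmul_eq_zero [Fintype R] (hR : ∀ x : R, IsUnit x ∨ (p : R) ∣ x)
    (hp : (p : R) ^ (a + 1) = 0) {n : R} (hn : n ≠ 0) {j : R} (hj : p • j = 0) :
    ∃ r, j = n * r := by
  classical
  have hex : ∃ k, (p : R) ^ k * n = 0 := ⟨a + 1, by rw [hp, zero_mul]⟩
  obtain ⟨k, hk⟩ : ∃ k, Nat.find hex = k + 1 := by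
    refine Nat.exists_eq_succ_of_ne_zero fun h => hn ?_
    have := Nat.find_spec hex
    rwa [h, pow_zero, one_mul] at this
  set j₀ := (p : R) ^ k * n with hj₀
  have hj₀0 : j₀ ≠ 0 := Nat.find_min hex (by omega)
  have hpj₀ : (p : R) * j₀ = 0 := by
    have := Nat.find_spec hex
    rw [hk] at this
    rw [hj₀, ← mul_assoc, ← pow_succ', this]
  set μ := AddMonoidHom.mulLeft j₀
  have hle : μ.range ≤ torsionKer R p := by
    rintro _ ⟨x, rfl⟩
    rw [mem_torsionKer, nsmul_eq_mul]
    change (p : R) * (j₀ * x) = 0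
    rw [← mul_assoc, hpj₀, zero_mul]
  have hker : μ.ker ≤ (nsmulAddMonoidHom (α := R) p).range := by
    intro x hx
    rcases hR x with hu | ⟨y, rfl⟩
    · exact absurd (hu.mul_left_eq_zero.1 hx) hj₀0
    · exact ⟨y, by simp⟩
  have h1 := μ.card_ker_mul_card_range
  have h2 := (nsmulAddMonoidHom (α := R) p).card_ker_mul_card_range
  have h3 := AddSubgroup.card_le_of_le hker
  have h4 : Nat.card (torsionKer R p) ≤ Nat.card μ.range := by
    have hpos : 0 < Nat.card (nsmulAddMonoidHom (α := R) p).range := Nat.card_pos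
    refine Nat.le_of_mul_le_mul_right ?_ hpos
    rw [h2, ← h1, mul_comm]
    exact Nat.mul_le_mul_left _ h3
  have heq := AddSubgroup.eq_of_le_of_card_ge hle h4
  have hjm : j ∈ μ.range := by rw [heq]; exact hj
  obtain ⟨r, hr⟩ := hjm
  refine ⟨p ^ k * r, ?_⟩
  rw [← hr]
  change j₀ * r = _
  rw [hj₀]
  ring

open Classical in
lemma card_mul_sum_isUnit [Fintype R] [Nontrivial R]
    (hR : ∀ x : R, IsUnit x ∨ (p : R) ∣ x) (hp : (p : R) ^ (a + 1) = 0)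
    (hq : Nat.card (torsionKer R p) = q) (ψ : AddChar R ℂ) :
    (q : ℂ) * ∑ x, (if IsUnit x then ψ x else 0) =
      q * (if ∀ x, ψ x = 1 then (Nat.card R : ℂ) else 0) -
        if ∀ x, ψ (p * x) = 1 then (Nat.card R : ℂ) else 0 := by
  have h1 := sum_comp_addMonoidHom (nsmulAddMonoidHom (α := R) p) ψ
  have h2 : ∑ x, ψ (p • x) = if ∀ x, ψ (p * x) = 1 then (Nat.card R : ℂ) else 0 := by
    have := AddChar.sum_eq_ite (ψ.compAddMonoidHom (nsmulAddMonoidHom (α := R) p))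
    simpa [AddChar.eq_zero_iff_forall, Nat.card_eq_fintype_card] using this
  have h3 : ∑ x, ψ x = if ∀ x, ψ x = 1 then (Nat.card R : ℂ) else 0 := by
    have := AddChar.sum_eq_ite ψ
    simpa [AddChar.eq_zero_iff_forall, Nat.card_eq_fintype_card] using this
  rw [← h2, ← h3]
  simp only [nsmulAddMonoidHom_apply] at h1
  rw [h1, hq, ← mul_sub, ← Finset.sum_sub_distrib]
  refine congrArg _ ?_
  refine Finset.sum_congr rfl fun x _ => ?_
  have h4 : x ∈ (nsmulAddMonoidHom (α := R) p).range ↔ ¬ IsUnit x := by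
    rw [isUnit_iff_not_dvd hR hp, not_not]
    constructor
    · rintro ⟨y, rfl⟩
      exact ⟨y, by simp⟩
    · rintro ⟨y, rfl⟩
      exact ⟨y, by simp⟩
  by_cases hx : IsUnit x <;> simp [h4, hx]

/-- The elements `z` of `R × R` with invertible first coordinate whose slope lies in class `i`. -/
def slopeSet {ι : Type*} (cls : R → ι) (i : ι) : Set (R × R) :=
  {z | IsUnit z.1 ∧ ∃ m, z.2 = z.1 * m ∧ cls m = i}

lemma mem_slopeSet_mul {ι : Type*} {cls : R → ι} {i : ι} {x m : R} (hx : IsUnit x) :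
    (x, x * m) ∈ slopeSet cls i ↔ cls m = i := by
  constructor
  · rintro ⟨-, m', h, rfl⟩
    rw [hx.mul_right_injective h]
  · exact fun h => ⟨hx, m, rfl, h⟩

open Classical in
lemma addCharSum_slopeSet [Fintype R] {ι : Type*} (cls : R → ι) (i : ι) (χ : AddChar (R × R) ℂ) :
    addCharSum χ (slopeSet cls i) =
      ∑ m, if cls m = i then ∑ x, (if IsUnit x then χ (x, x * m) else 0) else 0 := by
  have h1 : ∀ x : R, ∑ y, (slopeSet cls i).indicator χ (x, y) =
      ∑ m, if cls m = i then (if IsUnit x then χ (x, x * m) else 0) else 0 := by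
    intro x
    by_cases hx : IsUnit x
    · rw [← Equiv.sum_comp hx.unit.mulLeft]
      refine Finset.sum_congr rfl fun m _ => ?_
      rw [Units.mulLeft_apply, IsUnit.unit_spec, Set.indicator_apply, mem_slopeSet_mul hx,
        if_pos hx]
    · simp only [if_neg hx, ite_self, Finset.sum_const_zero]
      exact Finset.sum_eq_zero fun y _ => Set.indicator_of_notMem (fun h => hx h.1) _
  rw [addCharSum_eq_sum, Fintype.sum_prod_type]
  simp only [h1]
  rw [Finset.sum_comm]
  refine Finset.sum_congr rfl fun m _ => ?_
  split_ifs <;> simp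

/-- There is a classification of `R` by `Fin q` whose classes are transversals of `R[p]`. -/
lemma exists_classification [Fintype R] (hq : Nat.card (torsionKer R p) = q) :
    ∃ cls : R → Fin q, ∀ m i, ∃! m', p • (m' - m) = 0 ∧ cls m' = i := by
  let ε : torsionKer R p ≃ Fin q := Finite.equivFinOfCardEq hq
  let out : R → R := fun m => (Quotient.out (m : R ⧸ torsionKer R p) : R)
  have hout : ∀ m, m - out m ∈ torsionKer R p := by
    intro m
    rw [← QuotientAddGroup.eq_iff_sub_mem]
    exact (QuotientAddGroup.out_eq' _).symm
  have hout' : ∀ m m', p • (m' - m) = 0 → out m' = out m := by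
    intro m m' h
    have : (m' : R ⧸ torsionKer R p) = m := QuotientAddGroup.eq_iff_sub_mem.2 h
    simp only [out, this]
  refine ⟨fun m => ε ⟨m - out m, hout m⟩, fun m i => ⟨out m + ε.symm i, ⟨?_, ?_⟩, ?_⟩⟩
  · have h1 := (ε.symm i).2
    have h2 := (torsionKer R p).sub_mem h1 (hout m)
    rw [mem_torsionKer] at h2
    rw [← h2]
    congr 1
    ring
  · have h : out (out m + ε.symm i) = out m := by
      apply hout'
      have h1 := (ε.symm i).2
      have h2 := (torsionKer R p).sub_mem h1 (hout m)
      rw [mem_torsionKer] at h2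
      rw [← h2]
      congr 1
      ring
    rw [← Equiv.eq_symm_apply]
    apply Subtype.ext
    simp [h]
  · rintro m' ⟨h1, h2⟩
    have h3 : ε.symm i = ⟨m' - out m', hout m'⟩ := by rw [← h2, Equiv.symm_apply_apply]
    rw [h3, ← hout' m m' h1]
    exact (add_sub_cancel _ _).symm

open Classical in
lemma card_mul_sum_class [Fintype R] {ι : Type*} {cls : R → ι}
    (hcls : ∀ m i, ∃! m', p • (m' - m) = 0 ∧ cls m' = i)
    (hq : Nat.card (torsionKer R p) = q) (F : R → ℂ) (hF : ∀ m j, p • j = 0 → F (m + j) = F m)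
    (i : ι) : (q : ℂ) * ∑ m, (if cls m = i then F m else 0) = ∑ m, F m := by
  have h1 : (q : ℂ) * ∑ m, (if cls m = i then F m else 0) =
      ∑ j : torsionKer R p, ∑ m, if cls (m - j) = i then F m else 0 := by
    rw [← hq, Nat.card_eq_fintype_card, ← nsmul_eq_mul, ← Finset.card_univ, ← Finset.sum_const]
    refine Finset.sum_congr rfl fun j _ => ?_
    rw [← Equiv.sum_comp (Equiv.subRight (j : R))]
    refine Finset.sum_congr rfl fun m _ => ?_
    have := hF (m - j) j j.2
    rw [sub_add_cancel] at this
    rw [Equiv.subRight_apply, this]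
  rw [h1, Finset.sum_comm]
  refine Finset.sum_congr rfl fun m _ => ?_
  obtain ⟨m', ⟨h2, h3⟩, h4⟩ := hcls m i
  have h5 : m - m' ∈ torsionKer R p := by
    rw [← neg_sub]; exact (torsionKer R p).neg_mem h2
  rw [Finset.sum_eq_single (⟨m - m', h5⟩ : torsionKer R p)]
  · simp [h3]
  · intro j _ hj
    refine if_neg fun h => hj (Subtype.ext ?_)
    have h6 : m - j = m' := by
      refine h4 _ ⟨?_, h⟩
      rw [show m - (j : R) - m = -j by ring, smul_neg, mem_torsionKer.1 j.2, neg_zero]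
    change (j : R) = m - m'
    rw [← h6, sub_sub_cancel]
  · simp

end ChainRing

lemma addCharSum_image {A B : Type*} [AddCommGroup A] [AddCommGroup B] (f : A →+ B)
    (hf : Function.Injective f) (χ : AddChar B ℂ) (D : Set A) :
    addCharSum χ (f '' D) = addCharSum (χ.compAddMonoidHom f) D := by
  rw [addCharSum, addCharSum, ← finsum_mem_def, ← finsum_mem_def, finsum_mem_image hf.injOn]
  rfl

lemma addCharSum_union {A : Type*} [AddCommGroup A] [Finite A] (χ : AddChar A ℂ) {D E : Set A}
    (h : Disjoint D E) : addCharSum χ (D ∪ E) = addCharSum χ D + addCharSum χ E := by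
  rw [addCharSum, addCharSum, addCharSum, ← finsum_mem_def, ← finsum_mem_def, ← finsum_mem_def,
    finsum_mem_union h D.toFinite E.toFinite]

lemma addCharSum_preimage_eq_zero {X Y : Type*} [AddCommGroup X] [AddCommGroup Y] [Finite X]
    (f : X →+ Y) (ψ : AddChar X ℂ) {x₀ : X} (h₀ : f x₀ = 0) (hψ : ψ x₀ ≠ 1) (D : Set Y) :
    addCharSum ψ (f ⁻¹' D) = 0 := by
  classical
  have := Fintype.ofFinite X
  have h : addCharSum ψ (f ⁻¹' D) = ψ x₀ * addCharSum ψ (f ⁻¹' D) := by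
    rw [addCharSum_eq_sum, Finset.mul_sum, ← Equiv.sum_comp (Equiv.addLeft x₀)]
    refine Finset.sum_congr rfl fun x _ => ?_
    simp only [Set.indicator_apply, Equiv.coe_addLeft, Set.mem_preimage, map_add, h₀, zero_add,
      AddChar.map_add_eq_mul, mul_ite, mul_zero]
  have h2 : (ψ x₀ - 1) * addCharSum ψ (f ⁻¹' D) = 0 := by linear_combination -h
  exact (mul_eq_zero.1 h2).resolve_left (sub_ne_zero.2 hψ)

lemma addCharSum_preimage_comp {X Y : Type*} [AddCommGroup X] [AddCommGroup Y] [Finite X]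
    [Finite Y] (f : X →+ Y) (hf : Function.Surjective f) (χ : AddChar Y ℂ) (D : Set Y) :
    addCharSum (χ.compAddMonoidHom f) (f ⁻¹' D) = Nat.card f.ker * addCharSum χ D := by
  classical
  have := Fintype.ofFinite X
  have := Fintype.ofFinite Y
  rw [addCharSum_eq_sum, addCharSum_eq_sum]
  have h := sum_comp_addMonoidHom f (fun y => D.indicator χ y)
  simp only [AddMonoidHom.range_eq_top.2 hf, AddSubgroup.mem_top, if_true] at h
  rw [← h]
  rfl

lemma AddChar.exists_eq_comp {X Y : Type*} [AddCommGroup X] [AddCommGroup Y]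
    (f : X →+ Y) (hf : Function.Surjective f) (ψ : AddChar X ℂ) (hψ : ∀ x, f x = 0 → ψ x = 1) :
    ∃ χ : AddChar Y ℂ, ψ = χ.compAddMonoidHom f := by
  have key : ∀ x y, f x = f y → ψ x = ψ y := by
    intro x y h
    have h1 := hψ (x - y) (by rw [map_sub, h, sub_self])
    have h2 : ψ x = ψ (x - y) * ψ y := by rw [← AddChar.map_add_eq_mul, sub_add_cancel]
    rw [h2, h1, one_mul]
  refine ⟨⟨fun y => ψ (Function.surjInv hf y), ?_, ?_⟩, ?_⟩
  · exact hψ _ (Function.surjInv_eq hf 0)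
  · intro x y
    rw [← AddChar.map_add_eq_mul]
    exact key _ _ (by simp only [map_add, Function.surjInv_eq])
  · ext x
    exact key _ _ (Function.surjInv_eq hf _).symm

section ChainRing

variable {R : Type*} [CommRing R] {p q a : ℕ}

open Classical in
lemma addCharSum_slopeSet_of_trivial [Fintype R] [Nontrivial R]
    (hR : ∀ x : R, IsUnit x ∨ (p : R) ∣ x)
    (hp : (p : R) ^ (a + 1) = 0) (hq : Nat.card (torsionKer R p) = q) {ι : Type*} {cls : R → ι}
    (hcls : ∀ m i, ∃! m', p • (m' - m) = 0 ∧ cls m' = i) (χ : AddChar (R × R) ℂ)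
    (hχ : ∀ j : R, p • j = 0 → χ (0, j) = 1) (i : ι) :
    (q : ℂ) * (q * addCharSum χ (slopeSet cls i)) =
      (if ∀ y, χ (0, y) = 1 then (Nat.card R : ℂ) else 0) *
      (q * (if ∀ x, χ (x, 0) = 1 then (Nat.card R : ℂ) else 0) -
        if ∀ x, χ (p * x, 0) = 1 then (Nat.card R : ℂ) else 0) := by
  set χ₁ := χ.compAddMonoidHom (AddMonoidHom.inl R R)
  set χ₂ := χ.compAddMonoidHom (AddMonoidHom.inr R R)
  have hmul : ∀ x y, χ (x, y) = χ₁ x * χ₂ y := by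
    intro x y
    change _ = χ (x, 0) * χ (0, y)
    rw [← AddChar.map_add_eq_mul]
    simp
  have h3 : ∑ y, χ₂ y = if ∀ y, χ (0, y) = 1 then (Nat.card R : ℂ) else 0 := by
    rw [AddChar.sum_eq_ite χ₂, ← Nat.card_eq_fintype_card]
    simp only [AddChar.eq_zero_iff_forall]
    rfl
  have h4 := card_mul_sum_isUnit hR hp hq χ₁
  rw [addCharSum_slopeSet, card_mul_sum_class hcls hq, Finset.sum_comm]
  · have h5 : ∀ x : R, ∑ m, (if IsUnit x then χ (x, x * m) else 0) =
        (if IsUnit x then χ₁ x else 0) * ∑ y, χ₂ y := by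
      intro x
      by_cases hx : IsUnit x
      · simp only [if_pos hx, hmul, Finset.mul_sum]
        rw [← Equiv.sum_comp hx.unit.mulLeft (fun y => χ₁ x * χ₂ y)]
        simp
      · simp [hx]
    simp only [h5]
    rw [← Finset.sum_mul, h3, ← mul_assoc, h4, mul_comm]
    rfl
  · intro m j hj
    refine Finset.sum_congr rfl fun x _ => ?_
    split_ifs with hx
    · have h6 : χ₂ (x * j) = 1 := hχ _ (by rw [← mul_smul_comm, hj, mul_zero])
      rw [hmul, hmul, mul_add, AddChar.map_add_eq_mul, h6, mul_one]
    · rfl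

lemma addCharSum_slopeSet_of_nontrivial [Fintype R] [Nontrivial R]
    (hR : ∀ x : R, IsUnit x ∨ (p : R) ∣ x)
    (hp : (p : R) ^ (a + 1) = 0) (hq : Nat.card (torsionKer R p) = q) {ι : Type*} {cls : R → ι}
    (hcls : ∀ m i, ∃! m', p • (m' - m) = 0 ∧ cls m' = i) (χ : AddChar (R × R) ℂ)
    (hχ : ∃ j : R, p • j = 0 ∧ χ (0, j) ≠ 1) (i : ι) :
    (q : ℂ) * addCharSum χ (slopeSet cls i) = -Nat.card R ∨
      (q : ℂ) * addCharSum χ (slopeSet cls i) = q * Nat.card R - Nat.card R := by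
  classical
  set χ₁ := χ.compAddMonoidHom (AddMonoidHom.inl R R)
  set χ₂ := χ.compAddMonoidHom (AddMonoidHom.inr R R)
  have hmul : ∀ x y, χ (x, y) = χ₁ x * χ₂ y := by
    intro x y
    change _ = χ (x, 0) * χ (0, y)
    rw [← AddChar.map_add_eq_mul]
    simp
  obtain ⟨j, hj, hχj⟩ := hχ
  have htriv : ∀ n : R, (∀ x, χ₂ (n * x) = 1) → n = 0 := by
    intro n hn
    by_contra h0
    obtain ⟨r, rfl⟩ := exists_eq_mul_of_nsmul_eq_zero hR hp h0 hj
    exact hχj (hn r)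
  have hbij : Function.Bijective fun m : R => χ₂.mulShift m := by
    refine (Fintype.bijective_iff_injective_and_card _).2 ⟨fun m m' h => ?_, AddChar.card_eq.symm⟩
    refine sub_eq_zero.1 (htriv _ fun x => ?_)
    have h1 : χ₂ (m * x) = χ₂ (m' * x) := DFunLike.congr_fun h x
    rw [sub_mul, AddChar.map_sub_eq_div, h1, div_self (χ₂.val_isUnit _).ne_zero]
  obtain ⟨m₀, hm₀⟩ := hbij.2 (-χ₁)
  have hchar : ∀ x m, χ (x, x * m) = χ₂.mulShift (m - m₀) x := by
    intro x m
    have h1 : χ₂ (m₀ * x) = (-χ₁) x := DFunLike.congr_fun hm₀ x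
    rw [hmul, AddChar.mulShift_apply, sub_mul, AddChar.map_sub_eq_div, h1, AddChar.neg_apply',
      mul_comm x m]
    simp [mul_comm]
  have hsum : (q : ℂ) * addCharSum χ (slopeSet cls i) =
      ∑ m, if cls m = i then (q * (if m = m₀ then (Nat.card R : ℂ) else 0) -
        if p • (m - m₀) = 0 then (Nat.card R : ℂ) else 0) else 0 := by
    rw [addCharSum_slopeSet, Finset.mul_sum]
    refine Finset.sum_congr rfl fun m _ => ?_
    by_cases hc : cls m = i
    · simp only [if_pos hc, hchar]
      rw [card_mul_sum_isUnit hR hp hq]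
      have e1 : (∀ x, χ₂.mulShift (m - m₀) x = 1) ↔ m = m₀ := by
        refine ⟨fun h => sub_eq_zero.1 (htriv _ h), fun h x => ?_⟩
        rw [h, sub_self, AddChar.mulShift_apply, zero_mul, AddChar.map_zero_eq_one]
      have e2 : (∀ x, χ₂.mulShift (m - m₀) (p * x) = 1) ↔ p • (m - m₀) = 0 := by
        have h1 : ∀ x, χ₂.mulShift (m - m₀) (p * x) = χ₂ (p • (m - m₀) * x) := fun x => by
          rw [AddChar.mulShift_apply, nsmul_eq_mul]
          congr 1
          ring
        simp only [h1]
        refine ⟨htriv _, fun h x => ?_⟩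
        rw [h, zero_mul, AddChar.map_zero_eq_one]
      simp only [e1, e2]
    · simp only [if_neg hc, mul_zero]
  rw [hsum]
  obtain ⟨m', ⟨h1, h2⟩, h3⟩ := hcls m₀ i
  rw [Finset.sum_eq_single m']
  · rw [if_pos h2, if_pos h1]
    split_ifs
    · exact Or.inr rfl
    · left; ring
  · intro m _ hm
    by_cases h4 : cls m = i
    · have h5 : ¬ p • (m - m₀) = 0 := fun h => hm (h3 m ⟨h, h4⟩)
      have h6 : m ≠ m₀ := fun h => h5 (by rw [h, sub_self, smul_zero])
      rw [if_pos h4, if_neg h5, if_neg h6, mul_zero, sub_zero]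
    · rw [if_neg h4]
  · simp

end ChainRing

/-- A packing of the complement of `U` by `q` inversion-closed sets, each of which has the size and
the character sums of an `(n, n / q)` Latin square type partial difference set. -/
structure IsCharPacking {G : Type*} [AddCommGroup G] (U : AddSubgroup G) (q n : ℕ)
    (P : Fin q → Set G) : Prop where
  disjoint : ∀ i j, i ≠ j → Disjoint (P i) (P j)
  iUnion_eq : ⋃ i, P i = (U : Set G)ᶜ
  neg_mem : ∀ i g, g ∈ P i → -g ∈ P i
  sum_zero : ∀ i, (q : ℂ) * addCharSum 0 (P i) = n * (n - 1)
  sum_ne_zero : ∀ i χ, χ ≠ 0 →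
    (q : ℂ) * addCharSum χ (P i) = -n ∨ (q : ℂ) * addCharSum χ (P i) = q * n - n

lemma isCharPacking_lift {R : Type*} [CommRing R] [Finite R] [Nontrivial R] {p q a n : ℕ}
    (hR : ∀ x : R, IsUnit x ∨ (p : R) ∣ x) (hp : (p : R) ^ (a + 1) = 0)
    (hq : Nat.card (torsionKer R p) = q) (hn : Nat.card R = q * n)
    {G G' : Type*} [AddCommGroup G] [AddCommGroup G'] [Finite G] [Finite G']
    {H U V : AddSubgroup G} {U' : AddSubgroup G'} (hHV : H ≤ V) (hUV : U ≤ V)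
    (e : R × R ≃+ G) (heH : ∀ z, e z ∈ H ↔ z.1 = 0 ∧ p • z.2 = 0)
    (heV : ∀ z, e z ∈ V ↔ ¬ IsUnit z.1)
    (f : V →+ G') (hf : Function.Surjective f) (hfH : ∀ v, f v = 0 ↔ (v : G) ∈ H)
    (hfc : Nat.card f.ker = q) (hfU : ∀ v, f v ∈ U' ↔ (v : G) ∈ U)
    {P : Fin q → Set G'} (hP : IsCharPacking U' q n P) :
    ∃ Q : Fin q → Set G, IsCharPacking U q (q * n) Q := by
  classical
  have := Fintype.ofFinite R
  obtain ⟨cls, hcls⟩ := exists_classification hq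
  have hq0 : (q : ℂ) ≠ 0 := by
    rw [← hq]; exact_mod_cast Nat.card_pos.ne'
  set A : Fin q → Set G := fun i => V.subtype '' (f ⁻¹' P i) with hA
  set B : Fin q → Set G := fun i => e.toAddMonoidHom '' slopeSet cls i with hB
  have memA : ∀ i g, g ∈ A i ↔ ∃ h : g ∈ V, f ⟨g, h⟩ ∈ P i := by
    intro i g
    constructor
    · rintro ⟨v, hv, rfl⟩
      exact ⟨v.2, hv⟩
    · rintro ⟨h, hv⟩
      exact ⟨⟨g, h⟩, hv, rfl⟩
  have memB : ∀ i z, e z ∈ B i ↔ z ∈ slopeSet cls i := by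
    intro i z
    constructor
    · rintro ⟨w, hw, h⟩
      rwa [← e.injective h]
    · exact fun h => ⟨z, h, rfl⟩
  have hAB : ∀ i j, Disjoint (A i) (B j) := by
    intro i j
    rw [Set.disjoint_left]
    intro g hg hg'
    obtain ⟨z, rfl⟩ := e.surjective g
    obtain ⟨h, -⟩ := (memA _ _).1 hg
    exact (heV z).1 h ((memB _ _).1 hg').1
  have hsum : ∀ i χ, (q : ℂ) * addCharSum χ (A i ∪ B i) =
      q * addCharSum (χ.compAddMonoidHom V.subtype) (f ⁻¹' P i) +
      q * addCharSum (χ.compAddMonoidHom e.toAddMonoidHom) (slopeSet cls i) := by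
    intro i χ
    rw [addCharSum_union _ (hAB i i), hA, hB]
    simp only
    rw [addCharSum_image _ Subtype.val_injective, addCharSum_image _ e.injective, mul_add]
  have htriv : ∀ i χ, (∀ h ∈ H, χ h = 1) →
      ∃ χ' : AddChar G' ℂ, (χ' = 0 ↔ ∀ v ∈ V, χ v = 1) ∧
      (q : ℂ) * addCharSum χ (A i ∪ B i) = q * (q * addCharSum χ' (P i)) +
      (if χ' = 0 then (n : ℂ) * (q * (if χ = 0 then (q * n : ℂ) else 0) - q * n) else 0) := by
    intro i χ hχ
    obtain ⟨χ', hχ'⟩ := AddChar.exists_eq_comp f hf (χ.compAddMonoidHom V.subtype)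
      fun x hx => hχ _ ((hfH x).1 hx)
    have h0 : χ' = 0 ↔ ∀ v ∈ V, χ v = 1 := by
      rw [AddChar.eq_zero_iff_forall, hf.forall]
      have h1 : ∀ x, χ' (f x) = χ x := fun x => (DFunLike.congr_fun hχ' x).symm
      simp only [h1]
      exact Subtype.forall
    refine ⟨χ', h0, ?_⟩
    rw [hsum, hχ', addCharSum_preimage_comp f hf, hfc]
    refine congrArg _ ?_
    have h2 := addCharSum_slopeSet_of_trivial hR hp hq hcls (χ.compAddMonoidHom e.toAddMonoidHom)
      (fun j hj => hχ _ ((heH (0, j)).2 ⟨rfl, hj⟩)) i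
    have h3 : ∀ z, χ.compAddMonoidHom e.toAddMonoidHom z = χ (e z) := fun _ => rfl
    simp only [h3] at h2
    have hsplit : ∀ x y, χ (e (x, y)) = χ (e (x, 0)) * χ (e (0, y)) := by
      intro x y
      rw [← AddChar.map_add_eq_mul, ← map_add]
      simp
    have hnu : ∀ x : R, ¬ IsUnit x ↔ (p : R) ∣ x := fun x => by
      rw [isUnit_iff_not_dvd hR hp, not_not]
    apply mul_left_cancel₀ hq0
    rw [h2, hn]
    have hV : (∀ v ∈ V, χ v = 1) ↔ (∀ y, χ (e (0, y)) = 1) ∧ ∀ x, χ (e (p * x, 0)) = 1 := by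
      constructor
      · intro h
        exact ⟨fun y => h _ ((heV _).2 not_isUnit_zero),
          fun x => h _ ((heV _).2 ((hnu _).2 ⟨x, rfl⟩))⟩
      · rintro ⟨h4, h5⟩ v hv
        obtain ⟨⟨x, y⟩, rfl⟩ := e.surjective v
        obtain ⟨x, rfl⟩ := (hnu _).1 ((heV _).1 hv)
        rw [hsplit, h4, h5, one_mul]
    by_cases hX : ∀ y, χ (e (0, y)) = 1
    · have hY : (∀ x, χ (e (x, 0)) = 1) ↔ χ = 0 := by
        rw [AddChar.eq_zero_iff_forall]
        refine ⟨fun h g => ?_, fun h x => h _⟩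
        obtain ⟨⟨x, y⟩, rfl⟩ := e.surjective g
        rw [hsplit, h, hX, one_mul]
      simp only [hY, if_pos hX]
      by_cases hZ : ∀ x, χ (e (p * x, 0)) = 1
      · rw [if_pos hZ, if_pos (h0.2 (hV.2 ⟨hX, hZ⟩))]
        split_ifs <;> push_cast <;> ring
      · rw [if_neg hZ, if_neg fun h => hZ (hV.1 (h0.1 h)).2,
          if_neg fun h => hZ fun x => hY.2 h _]
        ring
    · rw [if_neg hX, if_neg fun h => hX (hV.1 (h0.1 h)).1]
      ring
  refine ⟨fun i => A i ∪ B i, ?_, ?_, ?_, ?_, ?_⟩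
  · intro i j hij
    rw [Set.disjoint_union_left, Set.disjoint_union_right, Set.disjoint_union_right]
    refine ⟨⟨?_, hAB i j⟩, (hAB j i).symm, ?_⟩
    · rw [Set.disjoint_left]
      intro g hg hg'
      obtain ⟨h, h1⟩ := (memA _ _).1 hg
      obtain ⟨_, h2⟩ := (memA _ _).1 hg'
      exact Set.disjoint_left.1 (hP.disjoint i j hij) h1 h2
    · rw [Set.disjoint_left]
      intro g hg hg'
      obtain ⟨⟨x, y⟩, rfl⟩ := e.surjective g
      obtain ⟨hx, m, hm, h1⟩ := (memB _ _).1 hg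
      simp only at hm hx
      subst hm
      rw [memB, mem_slopeSet_mul hx] at hg'
      exact hij (h1.symm.trans hg')
  · ext g
    simp only [Set.mem_iUnion, Set.mem_union, Set.mem_compl_iff, SetLike.mem_coe]
    obtain ⟨z, rfl⟩ := e.surjective g
    by_cases hg : e z ∈ V
    · have h1 : ∀ i, e z ∉ B i := fun i h => (heV z).1 hg ((memB _ _).1 h).1
      have h2 : ∀ i, e z ∈ A i ↔ f ⟨e z, hg⟩ ∈ P i := fun i =>
        (memA _ _).trans ⟨fun ⟨_, h⟩ => h, fun h => ⟨hg, h⟩⟩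
      simp only [h1, or_false, h2]
      rw [← Set.mem_iUnion, hP.iUnion_eq, Set.mem_compl_iff, SetLike.mem_coe, hfU]
    · refine ⟨fun _ h => hg (hUV h), fun _ => ?_⟩
      have hu : IsUnit z.1 := by
        by_contra h
        exact hg ((heV z).2 h)
      obtain ⟨u, hu'⟩ := hu
      refine ⟨cls (↑u⁻¹ * z.2), Or.inr ((memB _ _).2 ⟨⟨u, hu'⟩, _, ?_, rfl⟩)⟩
      rw [← hu', Units.mul_inv_cancel_left]
  · rintro i g (hg | hg)
    · left
      obtain ⟨h, h1⟩ := (memA _ _).1 hg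
      refine (memA _ _).2 ⟨V.neg_mem h, ?_⟩
      have := hP.neg_mem i _ h1
      rwa [← map_neg] at this
    · right
      obtain ⟨z, rfl⟩ := e.surjective g
      obtain ⟨hx, m, hm, h1⟩ := (memB _ _).1 hg
      rw [← map_neg, memB]
      exact ⟨hx.neg, m, by simp [hm], h1⟩
  · intro i
    obtain ⟨χ', h0, h1⟩ := htriv i 0 fun _ _ => rfl
    have h2 : χ' = 0 := h0.2 fun _ _ => rfl
    rw [h1, h2, hP.sum_zero, if_pos rfl, if_pos rfl]
    push_cast
    ring
  · intro i χ hχ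
    by_cases hH : ∀ h ∈ H, χ h = 1
    · obtain ⟨χ', h0, h1⟩ := htriv i χ hH
      rw [h1, if_neg hχ]
      by_cases h2 : χ' = 0
      · left
        rw [if_pos h2, h2, hP.sum_zero]
        push_cast
        ring
      · rw [if_neg h2]
        rcases hP.sum_ne_zero i χ' h2 with h | h
        · left
          rw [h]; push_cast; ring
        · right
          rw [h]; push_cast; ring
    · push Not at hH
      obtain ⟨h, hh, hχh⟩ := hH
      rw [hsum, addCharSum_preimage_eq_zero f (χ.compAddMonoidHom V.subtype)
        (x₀ := ⟨h, hHV hh⟩) ((hfH _).2 hh) hχh, mul_zero, zero_add, ← hn]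
      refine addCharSum_slopeSet_of_nontrivial hR hp hq hcls _ ?_ i
      obtain ⟨⟨x, y⟩, rfl⟩ := e.surjective h
      obtain ⟨h1, h2⟩ := (heH _).1 hh
      simp only at h1 h2
      subst h1
      exact ⟨y, h2, hχh⟩

lemma AddSubgroup.card_comap_of_le_range {X Y : Type*} [AddGroup X] [AddGroup Y] (f : X →+ Y)
    {K : AddSubgroup Y} (hK : K ≤ f.range) :
    Nat.card (K.comap f) = Nat.card K * Nat.card f.ker := by
  set g := f.comp (K.comap f).subtype with hg
  have hr : g.range = K := by
    ext y
    constructor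
    · rintro ⟨x, rfl⟩
      exact x.2
    · intro hy
      obtain ⟨x, rfl⟩ := hK hy
      exact ⟨⟨x, hy⟩, rfl⟩
  have hker : Nat.card g.ker = Nat.card f.ker := by
    refine Nat.card_congr ⟨fun x => ⟨x.1.1, x.2⟩, fun x => ⟨⟨x.1, ?_⟩, x.2⟩, fun _ => rfl,
      fun _ => rfl⟩
    have hx : f x.1 = 0 := x.2
    simp [AddSubgroup.mem_comap, hx]
  rw [← g.card_ker_mul_card_range, hr, hker, mul_comm]

lemma exists_isCharPacking {p s : ℕ} (hp : p.Prime) (hs : 0 < s) (a : ℕ) :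
    ∀ (G : Type) [AddCommGroup G] [Finite G], (∀ x : G, p ^ a • x = 0) →
    Nat.card G = (p ^ (2 * s)) ^ a → Nat.card (torsionKer G p) ≤ p ^ (2 * s) →
    ∀ U : AddSubgroup G, Nat.card U = p ^ (a * s) →
    ∃ P : Fin (p ^ s) → Set G, IsCharPacking U (p ^ s) (p ^ (a * s)) P := by
  induction a with
  | zero =>
    intro G _ _ hexp _ _ U _
    have h0 : ∀ x : G, x = 0 := fun x => by simpa using hexp x
    have hU : U = ⊤ := by
      ext x
      simp [h0 x]
    refine ⟨fun _ => ∅, by simp, by simp [hU], by simp, by simp [addCharSum], fun _ χ hχ => ?_⟩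
    refine (hχ ((AddChar.eq_zero_iff_forall χ).2 fun x => ?_)).elim
    rw [h0 x, AddChar.map_zero_eq_one]
  | succ a ih =>
    intro G _ _ hexp hG htG U hU
    obtain ⟨H, hHU, hHp, hH, hUH⟩ := exists_between_addSubgroup hp U hexp hU
    obtain ⟨R, _, _, b, hR⟩ := exists_galoisRing p (a + 1) s hp (Nat.succ_pos a) hs
    have : NeZero (p ^ (a + 1)) := ⟨(pow_pos hp.pos _).ne'⟩
    have : Finite R := Finite.of_equiv _ b.equivFun.symm.toEquiv
    have hcR : Nat.card R = (p ^ s) ^ (a + 1) := by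
      rw [Nat.card_congr b.equivFun.toEquiv, Nat.card_fun, Nat.card_fin, Nat.card_zmod,
        ← pow_mul, ← pow_mul, mul_comm]
    have hpR : (p : R) ^ (a + 1) = 0 := by
      rw [← Nat.cast_pow, ← map_natCast (algebraMap (ZMod (p ^ (a + 1))) R), ZMod.natCast_self,
        map_zero]
    have hexpR : ∀ x : R, p ^ (a + 1) • x = 0 := fun x => by
      rw [nsmul_eq_mul, Nat.cast_pow, hpR, zero_mul]
    have htR := card_torsionKer_eq hexpR hcR (card_torsionKer_le_of_basis b hp.pos)
    have h1s : 1 < p ^ s := Nat.one_lt_pow hs.ne' hp.one_lt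
    have hunit : ∀ x : R, p ^ a • x = 0 ↔ ¬ IsUnit x := by
      intro x
      constructor
      · intro h0 hx
        have hR0 : ∀ y : R, p ^ a • y = 0 := by
          intro y
          obtain ⟨z, rfl⟩ := hx.dvd (a := y)
          rw [← smul_mul_assoc, h0, zero_mul]
        rw [← htR] at h1s
        have := Finite.one_lt_card_iff_nontrivial.1 h1s
        obtain ⟨y, hy⟩ := exists_ne (0 : torsionKer R p)
        obtain ⟨z, hz⟩ := exists_pow_nsmul_eq hexpR hcR htR.le (mem_torsionKer.1 y.2)
        exact hy (Subtype.ext (hz.symm.trans (hR0 z)))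
      · intro hx
        obtain ⟨y, rfl⟩ := (hR x).resolve_left hx
        rw [nsmul_eq_mul, Nat.cast_pow, ← mul_assoc, ← pow_succ, hpR, zero_mul]
    have : Nontrivial R := by
      rw [← Finite.one_lt_card_iff_nontrivial, hcR]
      exact Nat.one_lt_pow (Nat.succ_ne_zero a) h1s
    obtain ⟨e, he⟩ := exists_addEquiv_prod hp b hcR hexp hG htG H hHp hH
    set F := nsmulAddMonoidHom (α := G) (p ^ a) with hF
    set V := H.comap F with hV
    have hUV : U ≤ V := hUH
    have hHV : H ≤ V := hHU.trans hUV
    have heV : ∀ z, e z ∈ V ↔ ¬ IsUnit z.1 := by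
      intro z
      rw [hV, AddSubgroup.mem_comap, hF, nsmulAddMonoidHom_apply, ← map_nsmul, he, ← hunit]
      refine and_iff_left ?_
      change p • (p ^ a • z.2) = 0
      rw [← mul_nsmul', ← pow_succ', hexpR]
    set f := QuotientAddGroup.mk' (H.addSubgroupOf V) with hf
    have hfs : Function.Surjective f := QuotientAddGroup.mk'_surjective _
    have hker : f.ker = H.addSubgroupOf V := QuotientAddGroup.ker_mk' _
    have hfH : ∀ v, f v = 0 ↔ (v : G) ∈ H := by
      intro v
      rw [← AddMonoidHom.mem_ker, hker, AddSubgroup.mem_addSubgroupOf]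
    have hfc : Nat.card f.ker = p ^ s := by
      rw [hker, Nat.card_congr (AddSubgroup.addSubgroupOfEquivOfLe hHV).toEquiv, hH]
    have hfr : f.range = ⊤ := AddMonoidHom.range_eq_top.2 hfs
    set U' := (U.addSubgroupOf V).map f with hU'
    have hcomap : U'.comap f = U.addSubgroupOf V := by
      rw [hU', AddSubgroup.comap_map_eq_self]
      rw [hker]
      exact fun x hx => hHU hx
    have hfU : ∀ v, f v ∈ U' ↔ (v : G) ∈ U := by
      intro v
      rw [← AddSubgroup.mem_comap, hcomap, AddSubgroup.mem_addSubgroupOf]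
    have hs0 : 0 < p ^ s := pow_pos hp.pos s
    have hFr : F.range = torsionKer G p := by
      ext x
      constructor
      · rintro ⟨y, rfl⟩
        rw [mem_torsionKer, hF, nsmulAddMonoidHom_apply, ← mul_nsmul', ← pow_succ', hexp]
      · exact fun hx => exists_pow_nsmul_eq hexp hG htG hx
    have htG' := card_torsionKer_eq hexp hG htG
    have hcV : Nat.card V = p ^ s * (p ^ (2 * s)) ^ a := by
      rw [hV, AddSubgroup.card_comap_of_le_range F (hFr ▸ hHp), hH]
      have h := F.card_ker_mul_card_range
      rw [hFr, htG', hG, pow_succ] at h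
      rw [Nat.eq_of_mul_eq_mul_right (pow_pos hp.pos _) h]
    have hG'c : Nat.card (V ⧸ H.addSubgroupOf V) = (p ^ (2 * s)) ^ a := by
      have h := f.card_ker_mul_card_range
      rw [hfc, hfr, AddSubgroup.card_top, hcV] at h
      exact Nat.eq_of_mul_eq_mul_left hs0 h
    have hG'exp : ∀ x : V ⧸ H.addSubgroupOf V, p ^ a • x = 0 := by
      intro x
      obtain ⟨v, rfl⟩ := hfs x
      rw [← map_nsmul, hfH]
      exact v.2
    have hG't : Nat.card (torsionKer (V ⧸ H.addSubgroupOf V) p) ≤ p ^ (2 * s) := by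
      have h := AddSubgroup.card_comap_of_le_range f
        (K := torsionKer (V ⧸ H.addSubgroupOf V) p) (hfr ▸ le_top)
      rw [hfc] at h
      refine Nat.le_of_mul_le_mul_right ?_ hs0
      rw [← h]
      set W := (torsionKer (V ⧸ H.addSubgroupOf V) p).comap f with hW
      set k := (nsmulAddMonoidHom (α := G) p).comp (V.subtype.comp W.subtype) with hk
      rw [← k.card_ker_mul_card_range]
      refine Nat.mul_le_mul (le_trans ?_ htG) (le_trans (AddSubgroup.card_le_of_le ?_) hH.le)
      · refine Nat.card_le_card_of_injective
          (fun x => (⟨x.1.1.1, x.2⟩ : torsionKer G p)) fun x y hxy => ?_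
        have h' := congrArg Subtype.val hxy
        exact Subtype.ext (Subtype.ext (Subtype.ext h'))
      · rintro _ ⟨x, rfl⟩
        have hx : p • f x.1 = 0 := x.2
        rw [← map_nsmul, hfH] at hx
        exact hx
    have hcU' : Nat.card U' = p ^ (a * s) := by
      have h := AddSubgroup.card_comap_of_le_range f (K := U') (hfr ▸ le_top)
      rw [hfc, hcomap, Nat.card_congr (AddSubgroup.addSubgroupOfEquivOfLe hUV).toEquiv, hU,
        add_mul, one_mul, pow_add] at h
      exact (Nat.eq_of_mul_eq_mul_right hs0 h).symm
    obtain ⟨P, hP⟩ := ih (V ⧸ H.addSubgroupOf V) hG'exp hG'c hG't U' hcU'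
    have hn : Nat.card R = p ^ s * p ^ (a * s) := by
      rw [hcR, ← pow_mul, ← pow_add]
      congr 1
      ring
    rw [show p ^ ((a + 1) * s) = p ^ s * p ^ (a * s) by rw [← pow_add]; congr 1; ring]
    exact isCharPacking_lift hR hpR htR hn hHV hUV e he heV f hfs hfH hfc hfU hP

lemma eq_of_forall_addChar_sum_eq {A : Type*} [AddCommGroup A] [Fintype A] {F F' : A → ℂ}
    (h : ∀ χ : AddChar A ℂ, ∑ g, χ g * F g = ∑ g, χ g * F' g) (a : A) : F a = F' a := by
  classical
  have key : ∀ E : A → ℂ, ∑ χ : AddChar A ℂ, χ (-a) * ∑ g, χ g * E g = Fintype.card A * E a := by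
    intro E
    simp_rw [Finset.mul_sum, ← mul_assoc, ← AddChar.map_add_eq_mul]
    rw [Finset.sum_comm]
    simp_rw [← Finset.sum_mul, AddChar.sum_apply_eq_ite, neg_add_eq_zero, ite_mul, zero_mul]
    rw [Finset.sum_ite_eq Finset.univ a, if_pos (Finset.mem_univ a)]
  have hc : (Fintype.card A : ℂ) ≠ 0 := Nat.cast_ne_zero.2 Fintype.card_ne_zero
  apply mul_left_cancel₀ hc
  rw [← key F, ← key F']
  exact Finset.sum_congr rfl fun χ _ => by rw [h]

open Classical in
/-- A symmetric set with the character sums of a Latin square type partial difference set has the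
difference counts of such a set. -/
lemma card_translate_of_addCharSum {A : Type*} [AddCommGroup A] [Finite A] {D : Set A} {n c : ℕ}
    (hA : Nat.card A = n ^ 2) (hneg : ∀ g ∈ D, -g ∈ D)
    (h0 : addCharSum 0 D = c * (n - 1))
    (h1 : ∀ χ, χ ≠ 0 → addCharSum χ D = -c ∨ addCharSum χ D = n - c) (g : A) :
    (Nat.card {y // g + y ∈ D ∧ y ∈ D} : ℂ) =
      (c ^ 2 - c) + (n - 2 * c) * (if g ∈ D then 1 else 0) +
        (c * n - c ^ 2) * (if g = 0 then 1 else 0) := by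
  have := Fintype.ofFinite A
  set I : A → ℂ := fun x => if x ∈ D then 1 else 0 with hI
  have hS : ∀ χ, addCharSum χ D = ∑ g, χ g * I g := by
    intro χ
    rw [addCharSum_eq_sum]
    refine Finset.sum_congr rfl fun g _ => ?_
    simp [Set.indicator_apply, hI]
  have hIneg : ∀ g, I (-g) = I g := fun g =>
    if_congr ⟨fun h => neg_neg g ▸ hneg _ h, hneg g⟩ rfl rfl
  have hcount : ∀ g, (Nat.card {y // g + y ∈ D ∧ y ∈ D} : ℂ) = ∑ y, I (g + y) * I y := by
    intro g
    rw [Nat.card_eq_fintype_card, Fintype.card_subtype, Finset.card_filter]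
    push_cast
    refine Finset.sum_congr rfl fun y _ => ?_
    simp only [hI, ite_and, mul_ite, mul_one, mul_zero]
    split_ifs <;> rfl
  rw [hcount]
  refine eq_of_forall_addChar_sum_eq (F := fun g => ∑ y, I (g + y) * I y)
    (F' := fun g => (c ^ 2 - c) + (n - 2 * c) * (if g ∈ D then 1 else 0) +
        (c * n - c ^ 2) * (if g = 0 then 1 else 0)) (fun χ => ?_) g
  have hL : ∑ g, χ g * ∑ y, I (g + y) * I y = addCharSum χ D * addCharSum χ D := by
    have h2 : addCharSum χ D = ∑ y, χ (-y) * I y := by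
      rw [hS, ← Equiv.sum_comp (Equiv.neg A)]
      exact Finset.sum_congr rfl fun g _ => by rw [Equiv.neg_apply, hIneg]
    nth_rewrite 2 [h2]
    rw [Finset.mul_sum]
    simp_rw [Finset.mul_sum]
    rw [Finset.sum_comm]
    refine Finset.sum_congr rfl fun y _ => ?_
    rw [hS, Finset.sum_mul,
      ← Equiv.sum_comp (Equiv.addRight y) fun g => χ g * I g * (χ (-y) * I y)]
    refine Finset.sum_congr rfl fun g _ => ?_
    rw [Equiv.coe_addRight, AddChar.map_add_eq_mul]
    have h3 : χ y * χ (-y) = 1 := by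
      rw [← AddChar.map_add_eq_mul, add_neg_cancel, AddChar.map_zero_eq_one]
    linear_combination -(χ g * I (g + y) * I y) * h3
  have hR : ∑ g, χ g * ((c ^ 2 - c) + (n - 2 * c) * (if g ∈ D then 1 else 0) +
        (c * n - c ^ 2) * (if g = 0 then 1 else 0)) =
      (c ^ 2 - c) * (if χ = 0 then (n : ℂ) ^ 2 else 0) + (n - 2 * c) * addCharSum χ D +
        (c * n - c ^ 2) := by
    have h4 : ∑ g, χ g = if χ = 0 then (n : ℂ) ^ 2 else 0 := by
      rw [AddChar.sum_eq_ite, ← Nat.card_eq_fintype_card, hA, Nat.cast_pow]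
    have h5 : ∑ g, χ g * (if g = 0 then (1 : ℂ) else 0) = 1 := by
      simp
    have h6 : ∀ g, χ g * ((c ^ 2 - c) + (n - 2 * c) * (if g ∈ D then 1 else 0) +
        (c * n - c ^ 2) * (if g = 0 then 1 else 0)) = (c ^ 2 - c) * χ g +
        (n - 2 * c) * (χ g * I g) + (c * n - c ^ 2) * (χ g * (if g = 0 then 1 else 0)) :=
      fun g => by simp only [hI]; ring
    simp_rw [h6]
    rw [Finset.sum_add_distrib, Finset.sum_add_distrib, ← Finset.mul_sum, ← Finset.mul_sum,
      ← Finset.mul_sum, h4, h5, hS, mul_one]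
  rw [hL, hR]
  by_cases hχ : χ = 0
  · rw [if_pos hχ, hχ, h0]
    ring
  · rw [if_neg hχ]
    rcases h1 χ hχ with h | h <;> rw [h] <;> ring

lemma IsCharPacking.isLatinPDS {A : Type*} [AddCommGroup A] [Finite A] {U : AddSubgroup A}
    {q c : ℕ} (hq : q ≠ 0) (hc : c ≠ 0) (hA : Nat.card A = (q * c) ^ 2) {P : Fin q → Set A}
    (hP : IsCharPacking U q (q * c) P) (i : Fin q) :
    IsLatinPDS (Multiplicative.toAdd ⁻¹' P i : Set (Multiplicative A)) (q * c) c := by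
  classical
  have hq0 : (q : ℂ) ≠ 0 := Nat.cast_ne_zero.2 hq
  have h0 : addCharSum 0 (P i) = c * ((q * c : ℕ) - 1) := by
    apply mul_left_cancel₀ hq0
    rw [hP.sum_zero]
    push_cast
    ring
  have h1 : ∀ χ, χ ≠ 0 → addCharSum χ (P i) = -c ∨ addCharSum χ (P i) = (q * c : ℕ) - c := by
    intro χ hχ
    refine (hP.sum_ne_zero i χ hχ).imp (fun h => ?_) (fun h => ?_) <;>
    · apply mul_left_cancel₀ hq0
      rw [h]
      push_cast
      ring
  have hcount := card_translate_of_addCharSum hA (hP.neg_mem i) h0 h1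
  have h0P : (0 : A) ∉ P i := by
    intro h
    have h2 : (0 : A) ∈ ⋃ i, P i := Set.mem_iUnion.2 ⟨i, h⟩
    rw [hP.iUnion_eq] at h2
    exact h2 U.zero_mem
  refine ⟨⟨hA, ?_, fun g hg => ?_⟩, h0P, ?_⟩
  · have h2 := hcount 0
    have h3 : Nat.card {y // 0 + y ∈ P i ∧ y ∈ P i} =
        Nat.card (Multiplicative.toAdd ⁻¹' P i : Set (Multiplicative A)) :=
      Nat.card_congr (Equiv.subtypeEquiv Multiplicative.ofAdd fun y => by simp)
    rw [h3, if_neg h0P, if_pos rfl] at h2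
    have h4 : 1 ≤ q * c := Nat.one_le_iff_ne_zero.2 (mul_ne_zero hq hc)
    apply Nat.cast_injective (R := ℂ)
    rw [h2]
    push_cast [h4]
    ring
  · have hg0 : g.toAdd ≠ 0 := hg
    have h2 := hcount g.toAdd
    have h3 : Nat.card {y // g.toAdd + y ∈ P i ∧ y ∈ P i} =
        diffCount (Multiplicative.toAdd ⁻¹' P i : Set (Multiplicative A)) g := by
      refine Nat.card_congr ⟨fun y => ⟨(g * Multiplicative.ofAdd y.1, Multiplicative.ofAdd y.1),
        y.2.1, y.2.2, ?_, ?_⟩, fun z => ⟨z.1.2.toAdd, ?_, z.2.2.1⟩, fun y => rfl, fun z => ?_⟩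
      · simpa using hg
      · simp
      · have h4 : g * z.1.2 = z.1.1 := (mul_inv_eq_iff_eq_mul.1 z.2.2.2.2).symm
        have h5 := z.2.1
        rw [← h4] at h5
        exact h5
      · have h4 : g * z.1.2 = z.1.1 := (mul_inv_eq_iff_eq_mul.1 z.2.2.2.2).symm
        exact Subtype.ext (Prod.ext h4 rfl)
    rw [h3, if_neg hg0] at h2
    constructor <;> intro hgP
    · rw [if_pos (show g.toAdd ∈ P i from hgP)] at h2
      apply Int.cast_injective (α := ℂ)
      push_cast at h2 ⊢
      rw [h2]
      ring
    · rw [if_neg (show g.toAdd ∉ P i from hgP)] at h2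
      apply Int.cast_injective (α := ℂ)
      push_cast at h2 ⊢
      rw [h2]
      ring
  · ext g
    rw [Set.mem_inv]
    exact ⟨fun h => inv_inv g ▸ hP.neg_mem i _ h, fun h => hP.neg_mem i _ h⟩

theorem stmt_14 (p a s : ℕ) (hp : p.Prime) (ha : 0 < a) (hs : 0 < s)
    (U : Subgroup (Multiplicative (Fin (2 * s) → ZMod (p ^ a))))
    (hU : Nat.card U = p ^ (a * s)) :
    ∃ P : Fin (p ^ s) → Set (Multiplicative (Fin (2 * s) → ZMod (p ^ a))),
      IsLPPacking (p ^ ((a - 1) * s)) (p ^ s) P U := by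
  have : NeZero (p ^ a) := ⟨(pow_pos hp.pos _).ne'⟩
  have hqn : p ^ s * p ^ ((a - 1) * s) = p ^ (a * s) := by
    obtain ⟨b, rfl⟩ := Nat.exists_eq_succ_of_ne_zero ha.ne'
    rw [← pow_add, Nat.succ_sub_one, Nat.succ_mul, add_comm]
  have hcard : Nat.card (Fin (2 * s) → ZMod (p ^ a)) = (p ^ (2 * s)) ^ a := by
    rw [Nat.card_fun, Nat.card_fin, Nat.card_zmod, ← pow_mul, ← pow_mul, mul_comm]
  have hcard' : Nat.card (Fin (2 * s) → ZMod (p ^ a)) = (p ^ s * p ^ ((a - 1) * s)) ^ 2 := by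
    rw [hcard, hqn, ← pow_mul, ← pow_mul]
    congr 1
    ring
  obtain ⟨P, hP⟩ := exists_isCharPacking hp hs a (Fin (2 * s) → ZMod (p ^ a))
    (fun x => by
      rw [← Nat.cast_smul_eq_nsmul (ZMod (p ^ a)), ZMod.natCast_self, zero_smul])
    hcard (card_torsionKer_le_of_basis (Pi.basisFun (ZMod (p ^ a)) (Fin (2 * s))) hp.pos)
    (AddSubgroup.toSubgroup.symm U) hU
  rw [← hqn] at hP
  refine ⟨fun i => Multiplicative.toAdd ⁻¹' P i, ?_, ?_, fun i => ?_, fun i j hij => ?_, ?_⟩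
  · rw [Nat.card_congr Multiplicative.toAdd, hcard', mul_pow]
  · rw [hU, hqn]
  · exact hP.isLatinPDS (pow_pos hp.pos _).ne' (pow_pos hp.pos _).ne' hcard' i
  · exact (hP.disjoint i j hij).preimage _
  · rw [← Set.preimage_iUnion, hP.iUnion_eq, ← Set.compl_eq_univ_sdiff]
    rfl
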